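/- Let f_c, f_m > 0, let η = f_c/f_m, let φ ∈ (−1,1) with η·φ ∈ (−1,1), let r > 0, and let φ̄ ∈ (−1,1), r̄ > 0. Then the two phase-matching conditions f_m·φ̄ = f_c·φ and f_m·(1−φ̄²)/(2r̄) = f_c·(1−φ²)/(2r) hold if and only if φ̄ = η·φ and r̄ = ((1 − η²·φ²)/(η·(1 − φ²)))·r. -/

import Mathlib

open Real

/-- Explicit location formula of Theorem 1: the phase-matching conditions
`f_m φ̄ = f_c φ` and `f_m (1−φ̄²)/(2r̄) = f_c (1−φ²)/(2r)` hold iff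
`φ̄ = η φ` and `r̄ = ((1 − η²φ²)/(η(1 − φ²)))·r`, where `η = f_c/f_m`. -/
theorem beam_split_location_formula (fc fm : ℝ) (hfc : 0 < fc) (hfm : 0 < fm)
    (η : ℝ) (hη : η = fc / fm)
    (φ : ℝ) (hφ : φ ∈ Set.Ioo (-1 : ℝ) 1) (hηφ : η * φ ∈ Set.Ioo (-1 : ℝ) 1)
    (r : ℝ) (hr : 0 < r)
    (φb : ℝ) (hφb : φb ∈ Set.Ioo (-1 : ℝ) 1) (rb : ℝ) (hrb : 0 < rb) :
    (fm * φb = fc * φ ∧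
        fm * (1 - φb ^ 2) / (2 * rb) = fc * (1 - φ ^ 2) / (2 * r)) ↔
      (φb = η * φ ∧ rb = ((1 - η ^ 2 * φ ^ 2) / (η * (1 - φ ^ 2))) * r) := by
  have hη_pos : 0 < η := hη ▸ div_pos hfc hfm
  obtain rfl : fc = η * fm := by rw [hη, div_mul_cancel₀ _ hfm.ne']
  have hcurv : 0 < 1 - φ ^ 2 := by nlinarith [hφ.1, hφ.2]
  have hdir : fm * φb = η * fm * φ ↔ φb = η * φ := by
    rw [show η * fm * φ = fm * (η * φ) by ring, mul_right_inj' hfm.ne']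
  rw [hdir]
  refine and_congr_right fun hφb_eq => ?_
  subst hφb_eq
  rw [div_eq_div_iff (by positivity) (by positivity), div_mul_eq_mul_div,
    eq_div_iff (by positivity)]
  constructor
  · intro h
    apply mul_left_cancel₀ (mul_ne_zero two_ne_zero hfm.ne')
    linear_combination -h
  · intro h
    linear_combination -2 * fm * h
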